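/- Characterization of the null space of S_y^α: let α > -1, y ≥ 0, and let φ : (0,∞) → ℍ be measurable with ∫_0^∞ ‖φ(x)‖² x^α e^{-x} dx < ∞. Then S_y^α φ(q) = 0 for every quaternion q with ‖q‖ < 1 if and only if for every n ∈ ℕ with L_n^{(α)}(y) ≠ 0 one has ∫_0^∞ φ_n^α(x) φ(x) x^α e^{-x} dx = 0; equivalently, the kernel of S_y^α is the closed span of the normalized Laguerre functions φ_n^α with L_n^{(α)}(y) = 0. -/

import Mathlib

open MeasureTheory Real Quaternion

/-- Generalized Laguerre polynomial `L_n^{(α)}(x)`. -/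
noncomputable def genLaguerre (α : ℝ) (n : ℕ) (x : ℝ) : ℝ :=
  ∑ k ∈ Finset.range (n + 1),
    ((-1 : ℝ) ^ k / (Nat.factorial k)) *
      (Real.Gamma (n + α + 1) / (Real.Gamma (k + α + 1) * (Nat.factorial (n - k)))) * x ^ k

/-- Normalized Laguerre function `φ_n^α(x)`. -/
noncomputable def lagPhi (α : ℝ) (n : ℕ) (x : ℝ) : ℝ :=
  Real.sqrt ((Nat.factorial n : ℝ) / Real.Gamma (n + α + 1)) * genLaguerre α n x

/-- The kernel `R_q^α(x,y) = Σ_n qⁿ φ_n^α(x) φ_n^α(y)`. -/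
noncomputable def Rker (α : ℝ) (q : ℍ[ℝ]) (x y : ℝ) : ℍ[ℝ] :=
  ∑' n : ℕ, (lagPhi α n x * lagPhi α n y) • q ^ n

/-- The dual transform `S_y^α φ(q) = ∫_0^∞ R_q^α(x,y) φ(x) x^α e^{-x} dx`. -/
noncomputable def Sdual (α y : ℝ) (φ : ℝ → ℍ[ℝ]) (q : ℍ[ℝ]) : ℍ[ℝ] :=
  ∫ x in Set.Ioi (0 : ℝ), (x ^ α * Real.exp (-x)) • (Rker α q x y * φ x)

lemma lag_gamma_shift (a : ℝ) (ha : 0 < a) (m : ℕ) :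
    Real.Gamma (a + m) = Real.Gamma a * (ascPochhammer ℝ m).eval a := by
  induction m with
  | zero => simp
  | succ m ih =>
    rw [ascPochhammer_succ_eval, ← mul_assoc, ← ih]
    have : a + ((m + 1 : ℕ) : ℝ) = (a + m) + 1 := by push_cast; ring
    rw [this, Real.Gamma_add_one (by positivity)]; ring

lemma lag_moment (α : ℝ) (hα : -1 < α) (m : ℕ) :
    IntegrableOn (fun x : ℝ => x ^ m * (x ^ α * Real.exp (-x))) (Set.Ioi 0) ∧
    ∫ x in Set.Ioi (0 : ℝ), x ^ m * (x ^ α * Real.exp (-x)) = Real.Gamma (m + α + 1) := by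
  have hs : 0 < (m : ℝ) + α + 1 := by have : (0:ℝ) ≤ m := by positivity
                                      linarith
  have heq : Set.EqOn (fun x : ℝ => Real.exp (-x) * x ^ ((m : ℝ) + α + 1 - 1))
      (fun x : ℝ => x ^ m * (x ^ α * Real.exp (-x))) (Set.Ioi 0) := by
    intro x hx
    have hx : 0 < x := hx
    simp only [add_sub_cancel_right]
    rw [Real.rpow_add hx, Real.rpow_natCast]; ring
  constructor
  · exact (Real.GammaIntegral_convergent hs).congr_fun heq measurableSet_Ioi
  · rw [Real.Gamma_eq_integral hs]
    exact (setIntegral_congr_fun measurableSet_Ioi heq).symm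

/-- The coefficients of the Laguerre polynomial. -/
noncomputable def lagCoef (α : ℝ) (n k : ℕ) : ℝ :=
  ((-1 : ℝ) ^ k / (Nat.factorial k)) *
      (Real.Gamma (n + α + 1) / (Real.Gamma (k + α + 1) * (Nat.factorial (n - k))))

lemma lag_eq (α : ℝ) (n : ℕ) (x : ℝ) :
    genLaguerre α n x = ∑ k ∈ Finset.range (n + 1), lagCoef α n k * x ^ k := rfl

lemma lag_gpos (α : ℝ) (hα : -1 < α) (n : ℕ) : 0 < Real.Gamma (n + α + 1) := by
  apply Real.Gamma_pos_of_pos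
  have : (0:ℝ) ≤ n := by positivity
  linarith

lemma lag_coef_eq (α : ℝ) (n k : ℕ) (hk : k ≤ n) :
    lagCoef α n k = Real.Gamma (n + α + 1) / n.factorial *
      ((-1) ^ k * n.choose k / Real.Gamma (k + α + 1)) := by
  rw [lagCoef, Nat.cast_choose ℝ hk]
  have := Nat.factorial_ne_zero n
  have h1 := Nat.factorial_ne_zero k
  have h2 := Nat.factorial_ne_zero (n-k)
  field_simp

lemma lag_sum (α : ℝ) (hα : -1 < α) (n m : ℕ) (hm : m ≤ n) :
    ∑ k ∈ Finset.range (n + 1), lagCoef α n k * Real.Gamma ((k + m : ℕ) + α + 1) =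
      if m = n then (-1) ^ n * Real.Gamma (n + α + 1) else 0 := by
  set P : Polynomial ℝ := (ascPochhammer ℝ m).comp (Polynomial.X + Polynomial.C (α + 1)) with hP
  have hdeg : P.natDegree = m := by
    rw [hP, Polynomial.natDegree_comp, ascPochhammer_natDegree, Polynomial.natDegree_X_add_C, mul_one]
  have hlead : P.leadingCoeff = 1 :=
    ((monic_ascPochhammer ℝ m).comp_X_add_C (α + 1))
  have key := fwdDiff_iter_eq_sum_shift (1 : ℝ) P.eval n 0
  have h1 : ∑ k ∈ Finset.range (n + 1), lagCoef α n k * Real.Gamma ((k + m : ℕ) + α + 1) =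
      Real.Gamma (n + α + 1) / n.factorial * (-1) ^ n *
       ∑ k ∈ Finset.range (n + 1), ((-1 : ℤ) ^ (n - k) * n.choose k) • P.eval (0 + k • (1:ℝ)) := by
    rw [Finset.mul_sum]
    apply Finset.sum_congr rfl
    intro k hk
    have hk : k ≤ n := by simpa [Nat.lt_succ_iff] using hk
    have hg := lag_gpos α hα k
    have e : ((k + m : ℕ) : ℝ) + α + 1 = (k + α + 1) + m := by push_cast; ring
    have hp : (0:ℝ) < k + α + 1 := by
      have : (0:ℝ) ≤ k := by positivity
      linarith
    rw [lag_coef_eq α n k hk, e, lag_gamma_shift _ hp]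
    have e2 : P.eval (0 + k • (1:ℝ)) = (ascPochhammer ℝ m).eval (k + α + 1) := by
      rw [hP]; simp [Polynomial.eval_comp, add_assoc]
    rw [e2, zsmul_eq_mul]
    push_cast
    have e3 : (-1 : ℝ) ^ n * (-1) ^ (n - k) = (-1) ^ k := by
      obtain ⟨j, rfl⟩ := Nat.exists_eq_add_of_le hk
      rw [Nat.add_sub_cancel_left, pow_add, mul_assoc, ← mul_pow]; simp
    rw [← e3]
    field_simp
  rw [h1, ← key]
  split_ifs with h
  · have := P.fwdDiff_iter_degree_eq_factorial
    rw [hdeg, hlead, h] at this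
    rw [this]
    have := Nat.factorial_ne_zero n
    simp
    field_simp
  · rw [Polynomial.fwdDiff_iter_eq_zero_of_degree_lt (by rw [hdeg]; omega)]
    simp

lemma lag_mul_mom (α : ℝ) (hα : -1 < α) (n m : ℕ) (hm : m ≤ n) :
    IntegrableOn (fun x : ℝ => genLaguerre α n x * (x ^ m * (x ^ α * Real.exp (-x)))) (Set.Ioi 0) ∧
    ∫ x in Set.Ioi (0 : ℝ), genLaguerre α n x * (x ^ m * (x ^ α * Real.exp (-x))) =
      if m = n then (-1) ^ n * Real.Gamma (n + α + 1) else 0 := by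
  have e : (fun x : ℝ => genLaguerre α n x * (x ^ m * (x ^ α * Real.exp (-x)))) =
      fun x => ∑ k ∈ Finset.range (n + 1), lagCoef α n k * (x ^ (k + m) * (x ^ α * Real.exp (-x))) := by
    ext x
    rw [lag_eq, Finset.sum_mul]
    apply Finset.sum_congr rfl
    intro k _
    rw [pow_add]; ring
  have hi : ∀ k ∈ Finset.range (n + 1), Integrable
      (fun x : ℝ => lagCoef α n k * (x ^ (k + m) * (x ^ α * Real.exp (-x))))
      (volume.restrict (Set.Ioi 0)) := fun k _ => (lag_moment α hα (k + m)).1.const_mul _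
  rw [e]
  refine ⟨integrable_finsetSum _ hi, ?_⟩
  rw [integral_finsetSum _ hi, ← lag_sum α hα n m hm]
  apply Finset.sum_congr rfl
  intro k _
  rw [integral_const_mul, (lag_moment α hα (k + m)).2]

lemma lagPhi_sq (α : ℝ) (hα : -1 < α) (n : ℕ) :
    IntegrableOn (fun x : ℝ => lagPhi α n x ^ 2 * (x ^ α * Real.exp (-x))) (Set.Ioi 0) ∧
    ∫ x in Set.Ioi (0 : ℝ), lagPhi α n x ^ 2 * (x ^ α * Real.exp (-x)) = 1 := by
  have hg := lag_gpos α hα n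
  have hf : (0:ℝ) < n.factorial := by positivity
  have e : (fun x : ℝ => lagPhi α n x ^ 2 * (x ^ α * Real.exp (-x))) =
      fun x => ∑ k ∈ Finset.range (n + 1), (n.factorial / Real.Gamma (n + α + 1) * lagCoef α n k) *
        (genLaguerre α n x * (x ^ k * (x ^ α * Real.exp (-x)))) := by
    ext x
    rw [lagPhi, mul_pow, Real.sq_sqrt (by positivity), sq (genLaguerre α n x)]
    nth_rewrite 2 [lag_eq]
    rw [Finset.mul_sum, Finset.mul_sum, Finset.sum_mul]
    apply Finset.sum_congr rfl
    intro k _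
    ring
  have hi : ∀ k ∈ Finset.range (n + 1), Integrable
      (fun x : ℝ => (n.factorial / Real.Gamma (n + α + 1) * lagCoef α n k) *
        (genLaguerre α n x * (x ^ k * (x ^ α * Real.exp (-x)))))
      (volume.restrict (Set.Ioi 0)) := fun k hk =>
        (lag_mul_mom α hα n k (by simpa [Nat.lt_succ_iff] using hk)).1.const_mul _
  rw [e]
  refine ⟨integrable_finsetSum _ hi, ?_⟩
  rw [integral_finsetSum _ hi]
  have : ∀ k ∈ Finset.range (n + 1), ∫ x in Set.Ioi (0:ℝ),
      (n.factorial / Real.Gamma (n + α + 1) * lagCoef α n k) *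
        (genLaguerre α n x * (x ^ k * (x ^ α * Real.exp (-x)))) =
      (n.factorial / Real.Gamma (n + α + 1) * lagCoef α n k) *
       if k = n then (-1) ^ n * Real.Gamma (n + α + 1) else 0 := by
    intro k hk
    rw [integral_const_mul, (lag_mul_mom α hα n k (by simpa [Nat.lt_succ_iff] using hk)).2]
  rw [Finset.sum_congr rfl this]
  simp only [mul_ite, mul_zero, Finset.sum_ite_eq', Finset.mem_range, Nat.lt_succ_self, if_true]
  rw [lag_coef_eq α n n le_rfl, Nat.choose_self]
  field_simp
  rw [← pow_mul]; simp

lemma lag_g_lower (α : ℝ) (hα : -1 < α) :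
    ∃ C : ℝ, 0 < C ∧ ∀ k : ℕ, (k.factorial : ℝ) / Real.Gamma (k + α + 1) ≤ C * 2 ^ k := by
  have h0 : 0 < α + 1 := by linarith
  refine ⟨1 / Real.Gamma (α + 1) + 1 / Real.Gamma (1 + α + 1), ?_, ?_⟩
  · have := Real.Gamma_pos_of_pos h0
    have := lag_gpos α hα 1
    push_cast at this
    positivity
  have hA := Real.Gamma_pos_of_pos h0
  have hB : 0 < Real.Gamma (1 + α + 1) := by have := lag_gpos α hα 1; push_cast at this; exact this
  intro k
  have key : ∀ j : ℕ, ((j+1).factorial : ℝ) / Real.Gamma ((j + 1 : ℕ) + α + 1) ≤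
      (j + 1) * (1 / Real.Gamma (1 + α + 1)) := by
    intro j
    induction j with
    | zero => simp
    | succ j ih =>
      have hj : (0:ℝ) ≤ j := by positivity
      have hp : (0:ℝ) < j + 1 + α + 1 := by linarith
      have e : (((j + 1 + 1 : ℕ) : ℝ) + α + 1) = ((j + 1 : ℕ) + α + 1) + 1 := by push_cast; ring
      have hg := lag_gpos α hα (j+1)
      rw [e, Real.Gamma_add_one (by push_cast; exact hp.ne'), Nat.factorial_succ]
      have : ((((j + 1 + 1) * (j + 1).factorial : ℕ)) : ℝ) /
          ((((j + 1 : ℕ) : ℝ) + α + 1) * Real.Gamma ((j + 1 : ℕ) + α + 1)) =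
          ((j + 1 + 1) / (j + 1 + α + 1)) * (((j+1).factorial : ℝ) / Real.Gamma ((j + 1 : ℕ) + α + 1)) := by
        push_cast
        push_cast at hg
        field_simp
      rw [this]
      calc _ ≤ ((j + 1 + 1 : ℝ) / (j + 1)) * ((j + 1) * (1 / Real.Gamma (1 + α + 1))) := by
            apply mul_le_mul _ ih (by positivity) (by positivity)
            apply div_le_div_of_nonneg_left (by positivity) (by positivity) (by linarith)
        _ = _ := by push_cast; field_simp
  rcases k with _ | j
  · simp; positivity
  · refine (key j).trans ?_
    have h2 : ((j:ℝ) + 1) ≤ 2 ^ (j + 1) := by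
      have := Nat.lt_two_pow_self (n := j+1)
      exact_mod_cast this.le
    calc _ ≤ (2:ℝ) ^ (j+1) * (1 / Real.Gamma (1 + α + 1)) := by gcongr
      _ ≤ _ := by
        rw [mul_comm]
        gcongr
        have : 0 < 1 / Real.Gamma (α+1) := by positivity
        linarith

lemma lag_g_summable (α : ℝ) (hα : -1 < α) (s : ℝ) (hs0 : 0 < s) (hs : s < 1) :
    Summable (fun n : ℕ => s ^ n * (Real.Gamma (n + α + 1) / n.factorial)) := by
  have hpos : ∀ n : ℕ, 0 < s ^ n * (Real.Gamma (n + α + 1) / n.factorial) := fun n => by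
    have := lag_gpos α hα n
    positivity
  refine summable_of_ratio_test_tendsto_lt_one hs (Filter.Eventually.of_forall fun n => (hpos n).ne') ?_
  have e : ∀ n : ℕ, ‖s ^ (n+1) * (Real.Gamma ((n+1 : ℕ) + α + 1) / (n+1).factorial)‖ /
      ‖s ^ n * (Real.Gamma (n + α + 1) / n.factorial)‖ = s * (1 + α * (1 / ((n : ℝ) + 1))) := by
    intro n
    rw [Real.norm_of_nonneg (hpos _).le, Real.norm_of_nonneg (hpos _).le]
    have hn : (0:ℝ) ≤ n := by positivity
    have e : (((n + 1 : ℕ) : ℝ) + α + 1) = (n + α + 1) + 1 := by push_cast; ring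
    have hg := lag_gpos α hα n
    rw [e, Real.Gamma_add_one (by linarith), Nat.factorial_succ]
    push_cast
    field_simp
    ring
  simp_rw [e]
  have := ((tendsto_one_div_add_atTop_nhds_zero_nat (𝕜 := ℝ)).const_mul α).const_add 1 |>.const_mul s
  simpa using this

lemma lagPhi_bound (α : ℝ) (hα : -1 < α) (y : ℝ) (hy : 0 ≤ y) (ε : ℝ) (hε : 0 < ε) :
    ∃ C : ℝ, 0 ≤ C ∧ ∀ n : ℕ, |lagPhi α n y| ≤
      C * (1 + Real.Gamma (n + α + 1) / n.factorial) * (1 + ε) ^ n := by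
  obtain ⟨C, hC, hCk⟩ := lag_g_lower α hα
  refine ⟨C * Real.exp (2 * y / ε), by positivity, fun n => ?_⟩
  have hg := lag_gpos α hα n
  set g := Real.Gamma (n + α + 1) / n.factorial with hgdef
  have hgp : 0 < g := by positivity
  have hL : |genLaguerre α n y| ≤ g * (C * Real.exp (2 * y / ε) * (1 + ε) ^ n) := by
    rw [lag_eq]
    refine (Finset.abs_sum_le_sum_abs _ _).trans ?_
    rw [add_comm 1 ε, add_pow, Finset.mul_sum, Finset.mul_sum]
    apply Finset.sum_le_sum
    intro k hk
    have hk : k ≤ n := by simpa [Nat.lt_succ_iff] using hk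
    have hgk := lag_gpos α hα k
    rw [lag_coef_eq α n k hk, ← hgdef, abs_mul, abs_mul, abs_of_pos hgp, abs_div, abs_mul, abs_pow, abs_neg, abs_one,
      one_pow, one_mul, abs_of_pos hgk, Nat.abs_cast, abs_of_nonneg (pow_nonneg hy k),
      one_pow, mul_one, mul_assoc]
    gcongr ?_ * ?_
    have hx := Real.pow_div_factorial_le_exp (2 * y / ε) (by positivity) k
    calc (n.choose k : ℝ) / Real.Gamma (k + α + 1) * y ^ k
        = n.choose k * (k.factorial / Real.Gamma (k + α + 1)) * (y ^ k / k.factorial) := by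
          field_simp
      _ ≤ n.choose k * (C * 2 ^ k) * (y ^ k / k.factorial) := by
          gcongr; exact hCk k
      _ = n.choose k * C * ε ^ k * ((2 * y / ε) ^ k / k.factorial) := by
          rw [div_pow, mul_pow]; field_simp
      _ ≤ n.choose k * C * ε ^ k * Real.exp (2 * y / ε) := by gcongr
      _ = _ := by ring
  have hs : Real.sqrt ((n.factorial : ℝ) / Real.Gamma (n + α + 1)) * g ≤ 1 + g := by
    have : (n.factorial : ℝ) / Real.Gamma (n + α + 1) = g⁻¹ := by rw [hgdef, inv_div]
    rw [this, Real.sqrt_inv]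
    have h1 : (Real.sqrt g)⁻¹ * g = Real.sqrt g := by
      have := Real.sq_sqrt hgp.le
      have h2 : 0 < Real.sqrt g := Real.sqrt_pos.2 hgp
      field_simp; linarith
    rw [h1]
    rw [Real.sqrt_le_left (by positivity)]
    nlinarith
  rw [lagPhi, abs_mul, abs_of_nonneg (Real.sqrt_nonneg _)]
  calc _ ≤ Real.sqrt ((n.factorial : ℝ) / Real.Gamma (n + α + 1)) *
        (g * (C * Real.exp (2 * y / ε) * (1 + ε) ^ n)) := by gcongr
    _ = (Real.sqrt ((n.factorial : ℝ) / Real.Gamma (n + α + 1)) * g) *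
        (C * Real.exp (2 * y / ε) * (1 + ε) ^ n) := by ring
    _ ≤ (1 + g) * (C * Real.exp (2 * y / ε) * (1 + ε) ^ n) := by gcongr
    _ = _ := by ring

lemma lagPhi_summable (α : ℝ) (hα : -1 < α) (y : ℝ) (hy : 0 ≤ y) (r : ℝ) (hr0 : 0 ≤ r) (hr : r < 1) :
    Summable (fun n : ℕ => r ^ n * |lagPhi α n y|) := by
  set t := (r + 1) / 2 with ht
  have ht0 : 0 < t := by rw [ht]; linarith
  have ht1 : t < 1 := by rw [ht]; linarith
  have hrt : r < t := by rw [ht]; linarith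
  have htt : t < (t + 1) / 2 := by linarith
  obtain ⟨C, hC, hb⟩ := lagPhi_bound α hα y hy ((t + 1) / 2 / t - 1) (by
    have : 1 < (t + 1) / 2 / t := by rw [lt_div_iff₀ ht0]; linarith
    linarith)
  set s := (t + 1) / 2 with hsdef
  have hs0 : 0 < s := by linarith
  have hs1 : s < 1 := by rw [hsdef]; linarith
  have hsum := ((summable_geometric_of_lt_one hs0.le hs1).add
    (lag_g_summable α hα s hs0 hs1)).mul_left C
  refine Summable.of_nonneg_of_le (fun n => by positivity) (fun n => ?_) hsum
  have hg := lag_gpos α hα n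
  calc r ^ n * |lagPhi α n y| ≤ t ^ n * (C * (1 + Real.Gamma (n + α + 1) / n.factorial) *
        (1 + (s / t - 1)) ^ n) := by
        gcongr
        exact hb n
    _ = C * (1 + Real.Gamma (n + α + 1) / n.factorial) * (t * (1 + (s / t - 1))) ^ n := by
        rw [mul_pow]; ring
    _ = _ := by
        have : t * (1 + (s / t - 1)) = s := by field_simp; ring
        rw [this]; ring

lemma lag_power_zero (a : ℕ → ℍ[ℝ]) (h : ∀ t : ℝ, |t| < 1 → HasSum (fun n => t ^ n • a n) 0)
    (n : ℕ) : a n = 0 := by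
  set p : FormalMultilinearSeries ℝ ℝ ℍ[ℝ] :=
    fun n => ContinuousMultilinearMap.mkPiRing ℝ (Fin n) (a n) with hp
  have hc : ∀ n, p.coeff n = a n := by
    intro n
    simp [FormalMultilinearSeries.coeff, hp]
  have hps : HasFPowerSeriesAt (fun _ : ℝ => (0 : ℍ[ℝ])) p 0 := by
    rw [hasFPowerSeriesAt_iff]
    filter_upwards [Metric.ball_mem_nhds (0:ℝ) one_pos] with t ht
    simp only [hc]
    exact h t (by simpa using ht)
  have h0 : p = 0 := hps.eq_zero
  rw [← hc, FormalMultilinearSeries.coeff_eq_zero, h0]; rfl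

lemma lag_meas (α : ℝ) (n : ℕ) :
    Measurable (fun x : ℝ => lagPhi α n x * (x ^ α * Real.exp (-x))) := by
  unfold lagPhi genLaguerre
  fun_prop

lemma lag_integrable (α : ℝ) (hα : -1 < α) (φ : ℝ → ℍ[ℝ])
    (hmeas : AEStronglyMeasurable φ (volume.restrict (Set.Ioi 0)))
    (hL2 : (∫⁻ x in Set.Ioi (0 : ℝ),
      ENNReal.ofReal (‖φ x‖ ^ 2 * (x ^ α * Real.exp (-x)))) < ⊤) :
    ∃ M : ℝ, 0 ≤ M ∧ ∀ n : ℕ,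
      IntegrableOn (fun x => (lagPhi α n x * (x ^ α * Real.exp (-x))) • φ x) (Set.Ioi 0) ∧
      ∫ x in Set.Ioi (0 : ℝ), ‖(lagPhi α n x * (x ^ α * Real.exp (-x))) • φ x‖ ≤ M := by
  have hw : ∀ x ∈ Set.Ioi (0:ℝ), 0 ≤ x ^ α * Real.exp (-x) := fun x hx => by
    have : 0 < x := hx
    positivity
  have hφ : Integrable (fun x => ‖φ x‖ ^ 2 * (x ^ α * Real.exp (-x)))
      (volume.restrict (Set.Ioi 0)) := by
    refine ⟨(hmeas.norm.pow 2).mul (Measurable.aestronglyMeasurable (by fun_prop)), ?_⟩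
    rw [hasFiniteIntegral_iff_ofReal]
    · exact hL2
    · filter_upwards [ae_restrict_mem measurableSet_Ioi] with x hx
      have := hw x hx
      positivity
  refine ⟨1 + ∫ x in Set.Ioi (0:ℝ), ‖φ x‖ ^ 2 * (x ^ α * Real.exp (-x)), ?_, fun n => ?_⟩
  · have : 0 ≤ ∫ x in Set.Ioi (0:ℝ), ‖φ x‖ ^ 2 * (x ^ α * Real.exp (-x)) :=
      setIntegral_nonneg measurableSet_Ioi fun x hx => by
        have := hw x hx
        positivity
    linarith
  have hb : ∀ x ∈ Set.Ioi (0:ℝ), ‖(lagPhi α n x * (x ^ α * Real.exp (-x))) • φ x‖ ≤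
      lagPhi α n x ^ 2 * (x ^ α * Real.exp (-x)) + ‖φ x‖ ^ 2 * (x ^ α * Real.exp (-x)) := by
    intro x hx
    have h1 := hw x hx
    rw [norm_smul, Real.norm_eq_abs, abs_mul, abs_of_nonneg h1, ← sq_abs (lagPhi α n x), ← add_mul]
    have : |lagPhi α n x| * ‖φ x‖ ≤ |lagPhi α n x| ^ 2 + ‖φ x‖ ^ 2 := by
      nlinarith [sq_nonneg (|lagPhi α n x| - ‖φ x‖), sq_nonneg (|lagPhi α n x|), sq_nonneg ‖φ x‖]
    calc _ = (|lagPhi α n x| * ‖φ x‖) * (x ^ α * Real.exp (-x)) := by ring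
      _ ≤ _ := by gcongr
  have hdom := (lagPhi_sq α hα n).1.integrable.add hφ
  have hint : Integrable (fun x => (lagPhi α n x * (x ^ α * Real.exp (-x))) • φ x)
      (volume.restrict (Set.Ioi 0)) := by
    refine hdom.mono' ((lag_meas α n).aestronglyMeasurable.smul hmeas) ?_
    filter_upwards [ae_restrict_mem measurableSet_Ioi] with x hx
    exact hb x hx
  refine ⟨hint, ?_⟩
  rw [← (lagPhi_sq α hα n).2, ← integral_add (lagPhi_sq α hα n).1.integrable hφ]
  exact setIntegral_mono_on hint.norm hdom measurableSet_Ioi hb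

lemma lag_hasSum (α y : ℝ) (hα : -1 < α) (hy : 0 ≤ y) (φ : ℝ → ℍ[ℝ])
    (hmeas : AEStronglyMeasurable φ (volume.restrict (Set.Ioi 0)))
    (hL2 : (∫⁻ x in Set.Ioi (0 : ℝ),
      ENNReal.ofReal (‖φ x‖ ^ 2 * (x ^ α * Real.exp (-x)))) < ⊤) (q : ℍ[ℝ]) (hq : ‖q‖ < 1) :
    HasSum (fun n : ℕ => q ^ n * (lagPhi α n y •
      ∫ x in Set.Ioi (0 : ℝ), (lagPhi α n x * (x ^ α * Real.exp (-x))) • φ x)) (Sdual α y φ q) := by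
  obtain ⟨M, hM, hn⟩ := lag_integrable α hα φ hmeas hL2
  set L : ℕ → ℍ[ℝ] →L[ℝ] ℍ[ℝ] := fun n => lagPhi α n y • ContinuousLinearMap.mul ℝ ℍ[ℝ] (q ^ n)
    with hL
  have hLv : ∀ n v, L n v = q ^ n * (lagPhi α n y • v) := by
    intro n v
    simp [hL]
  set f : ℕ → ℝ → ℍ[ℝ] := fun n x => (lagPhi α n x * (x ^ α * Real.exp (-x))) • φ x with hf
  have hI : ∀ n, Integrable (fun x => L n (f n x)) (volume.restrict (Set.Ioi 0)) :=
    fun n => (L n).integrable_comp (hn n).1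
  have hS : Summable fun n => ∫ x in Set.Ioi (0:ℝ), ‖L n (f n x)‖ := by
    refine Summable.of_nonneg_of_le (fun n => integral_nonneg fun x => norm_nonneg _) (fun n => ?_)
      ((lagPhi_summable α hα y hy ‖q‖ (norm_nonneg _) hq).mul_right M)
    have e : ∀ x, ‖L n (f n x)‖ = (‖q‖ ^ n * |lagPhi α n y|) * ‖f n x‖ := by
      intro x
      rw [hLv, norm_mul, norm_pow, norm_smul, Real.norm_eq_abs, mul_assoc]
    simp_rw [e]
    rw [integral_const_mul]
    exact mul_le_mul_of_nonneg_left (hn n).2 (by positivity)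
  have key := hasSum_integral_of_summable_integral_norm hI hS
  have e1 : ∀ n, ∫ x in Set.Ioi (0:ℝ), L n (f n x) = q ^ n * (lagPhi α n y •
      ∫ x in Set.Ioi (0 : ℝ), f n x) := fun n => by
    rw [(L n).integral_comp_comm (hn n).1, hLv]
  simp_rw [e1] at key
  have e2 : Sdual α y φ q = ∫ x in Set.Ioi (0:ℝ), ∑' n, L n (f n x) := by
    rw [Sdual]
    congr 1
    ext1 x
    rw [Rker, ← tsum_mul_right, ← tsum_const_smul'']
    congr 1
    ext1 n
    rw [hLv, hf]
    simp only [smul_mul_assoc, mul_smul_comm, smul_smul]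
    congr 1
    ring
  rw [e2]
  exact key

/-- Characterization of the null space of `S_y^α`: `φ` lies in the kernel iff it is
orthogonal to every Laguerre function `φ_n^α` with `L_n^{(α)}(y) ≠ 0`. -/
theorem stmt_11 (α y : ℝ) (hα : -1 < α) (hy : 0 ≤ y) (φ : ℝ → ℍ[ℝ])
    (hmeas : AEStronglyMeasurable φ (volume.restrict (Set.Ioi 0)))
    (hL2 : (∫⁻ x in Set.Ioi (0 : ℝ),
      ENNReal.ofReal (‖φ x‖ ^ 2 * (x ^ α * Real.exp (-x)))) < ⊤) :
    (∀ q : ℍ[ℝ], ‖q‖ < 1 → Sdual α y φ q = 0) ↔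
      ∀ n : ℕ, genLaguerre α n y ≠ 0 →
        (∫ x in Set.Ioi (0 : ℝ), (lagPhi α n x * (x ^ α * Real.exp (-x))) • φ x) = 0 := by
  constructor
  · intro h n hn
    have hz := lag_power_zero (fun n => lagPhi α n y •
      ∫ x in Set.Ioi (0 : ℝ), (lagPhi α n x * (x ^ α * Real.exp (-x))) • φ x) (fun t ht => by
        have hq : ‖((t : ℝ) : ℍ[ℝ])‖ < 1 := by rw [Quaternion.norm_coe]; exact ht
        have h1 := lag_hasSum α y hα hy φ hmeas hL2 (t : ℍ[ℝ]) hq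
        rw [h _ hq] at h1
        refine h1.congr_fun ?_
        intro n
        rw [← Quaternion.coe_pow, Quaternion.coe_mul_eq_smul, smul_comm]) n
    rcases smul_eq_zero.1 hz with h0 | h0
    · exfalso
      have hg := lag_gpos α hα n
      have hf : (0:ℝ) < n.factorial := by positivity
      have hs : 0 < Real.sqrt ((n.factorial : ℝ) / Real.Gamma (n + α + 1)) :=
        Real.sqrt_pos.2 (by positivity)
      exact (mul_ne_zero hs.ne' hn) h0
    · exact h0
  · intro h q hq
    have h1 := lag_hasSum α y hα hy φ hmeas hL2 q hq
    refine h1.unique ?_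
    convert hasSum_zero using 2 with n
    by_cases hn : genLaguerre α n y = 0
    · simp [lagPhi, hn]
    · simp [h n hn]
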